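/- (The singular white noise belongs to the Hida distribution space, coefficient form.) For every t ∈ ℝ and every real q ≥ 2, the series Σ_{k=1}^∞ e_k(t)²·(2k)^{−q} converges. -/

import Mathlib

open MeasureTheory

noncomputable section

/-- The `n`-th probabilists' Hermite polynomial
`hₙ(x) = (−1)ⁿ e^{x²/2} (dⁿ/dxⁿ) e^{−x²/2}`. -/
def hermiteP (n : ℕ) (x : ℝ) : ℝ :=
  (-1 : ℝ)^n * Real.exp (x^2 / 2) * iteratedDeriv n (fun y => Real.exp (-(y^2) / 2)) x

/-- The `k`-th Hermite function (`k ≥ 1`):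
`e_k(x) = π^{−1/4} ((k−1)!)^{−1/2} e^{−x²/2} h_{k−1}(√2 x)`. -/
def hermiteFun (k : ℕ) (x : ℝ) : ℝ :=
  Real.pi ^ (-(1/4) : ℝ) * ((Nat.factorial (k - 1) : ℝ)) ^ (-(1/2) : ℝ) *
    Real.exp (-(x^2) / 2) * hermiteP (k - 1) (Real.sqrt 2 * x)

open Polynomial in
theorem derivative_hermite_succ (n : ℕ) :
    derivative (hermite (n + 1)) = ((n : ℤ[X]) + 1) * hermite n := by
  induction n with
  | zero => simp
  | succ n ih =>
    rw [hermite_succ (n + 1), ih, derivative_sub, derivative_mul, derivative_mul, derivative_X,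
      derivative_add, derivative_natCast, derivative_one, ih]
    push_cast
    linear_combination -((n : ℤ[X]) + 1) * hermite_succ n

open Polynomial in
theorem aeval_hermite_add_two (n : ℕ) (x : ℝ) :
    aeval x (hermite (n + 2)) =
      x * aeval x (hermite (n + 1)) - ((n : ℝ) + 1) * aeval x (hermite n) := by
  rw [hermite_succ (n + 1), derivative_hermite_succ]
  simp

theorem hermiteP_eq_aeval (n : ℕ) (x : ℝ) :
    hermiteP n x = Polynomial.aeval x (Polynomial.hermite n) := by
  rw [Polynomial.hermite_eq_deriv_gaussian', hermiteP, iteratedDeriv_eq_iterate]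
  simp only [neg_div]
  ring

theorem hermiteP_add_two (n : ℕ) (x : ℝ) :
    hermiteP (n + 2) x = x * hermiteP (n + 1) x - ((n : ℝ) + 1) * hermiteP n x := by
  simp only [hermiteP_eq_aeval, aeval_hermite_add_two]

/-- The Turán-type energy of the three-term recurrence of the Hermite polynomials. -/
def hermiteEnergy (x : ℝ) (n : ℕ) : ℝ :=
  (hermiteP (n + 1) x ^ 2 + ((n : ℝ) + 1) * hermiteP n x ^ 2 -
    x * hermiteP (n + 1) x * hermiteP n x) / n.factorial

theorem hermiteEnergy_succ (x : ℝ) (n : ℕ) :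
    hermiteEnergy x (n + 1) =
      hermiteEnergy x n + hermiteP (n + 1) x ^ 2 / (n + 1).factorial := by
  have h : (n.factorial : ℝ) ≠ 0 := by positivity
  have h' : (n : ℝ) + 1 ≠ 0 := by positivity
  rw [hermiteEnergy, hermiteEnergy, hermiteP_add_two, Nat.factorial_succ]
  push_cast
  field_simp
  ring

theorem mul_sq_hermiteP_le_hermiteEnergy (x : ℝ) (n : ℕ) :
    ((n : ℝ) + 1 - x ^ 2 / 4) * (hermiteP (n + 1) x ^ 2 / (n + 1).factorial) ≤
      hermiteEnergy x n := by
  have h : (n.factorial : ℝ) ≠ 0 := by positivity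
  have h' : (n : ℝ) + 1 ≠ 0 := by positivity
  have key : hermiteEnergy x n -
      ((n : ℝ) + 1 - x ^ 2 / 4) * (hermiteP (n + 1) x ^ 2 / (n + 1).factorial) =
      (((n : ℝ) + 1) * hermiteP n x - x / 2 * hermiteP (n + 1) x) ^ 2 / (n + 1).factorial := by
    rw [hermiteEnergy, Nat.factorial_succ]
    push_cast
    field_simp
    ring
  rw [← sub_nonneg, key]
  positivity

theorem sq_hermiteP_div_factorial_le {x : ℝ} {n : ℕ} (hn : 3 / 4 * x ^ 2 ≤ n + 1) :
    hermiteP (n + 1) x ^ 2 / (n + 1).factorial ≤ 3 / 2 / ((n : ℝ) + 1) * hermiteEnergy x n := by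
  have h0 : 0 ≤ hermiteP (n + 1) x ^ 2 / (n + 1).factorial := by positivity
  rw [div_mul_eq_mul_div, le_div_iff₀ (by positivity)]
  nlinarith [mul_sq_hermiteP_le_hermiteEnergy x n]

theorem hermiteEnergy_le {x : ℝ} {N n : ℕ} (hN : 3 / 4 * x ^ 2 ≤ N) (hn : N ≤ n) :
    0 ≤ hermiteEnergy x n ∧
      hermiteEnergy x n ≤ hermiteEnergy x N * ((n : ℝ) + 1) ^ (3 / 2 : ℝ) := by
  have nonneg (m : ℕ) (hm : N ≤ m) : 0 ≤ hermiteEnergy x m := by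
    have : (N : ℝ) ≤ m := by exact_mod_cast hm
    refine le_trans (mul_nonneg ?_ (by positivity)) (mul_sq_hermiteP_le_hermiteEnergy x m)
    nlinarith [sq_nonneg x]
  refine ⟨nonneg n hn, ?_⟩
  induction n, hn using Nat.le_induction with
  | base =>
    exact le_mul_of_one_le_right (nonneg N le_rfl)
      (Real.one_le_rpow (by simp) (by norm_num))
  | succ n hn ih =>
    have hNn : (N : ℝ) ≤ n := by exact_mod_cast hn
    have bernoulli : 1 + 3 / 2 * (1 / ((n : ℝ) + 1)) ≤ (1 + 1 / ((n : ℝ) + 1)) ^ (3 / 2 : ℝ) :=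
      one_add_mul_self_le_rpow_one_add
        (le_trans (by norm_num) (by positivity : (0 : ℝ) ≤ 1 / ((n : ℝ) + 1))) (by norm_num)
    have hmul : ((n : ℝ) + 1) ^ (3 / 2 : ℝ) * (1 + 1 / ((n : ℝ) + 1)) ^ (3 / 2 : ℝ) =
        (((n + 1 : ℕ) : ℝ) + 1) ^ (3 / 2 : ℝ) := by
      rw [← Real.mul_rpow (by positivity) (by positivity)]
      congr 1
      push_cast
      field_simp
    calc hermiteEnergy x (n + 1)
        ≤ hermiteEnergy x n * (1 + 3 / 2 * (1 / ((n : ℝ) + 1))) := by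
          rw [hermiteEnergy_succ]
          have := sq_hermiteP_div_factorial_le (x := x) (n := n) (by linarith)
          calc _ ≤ hermiteEnergy x n + _ := add_le_add_right this _
            _ = _ := by ring
      _ ≤ (hermiteEnergy x N * ((n : ℝ) + 1) ^ (3 / 2 : ℝ)) *
          (1 + 1 / ((n : ℝ) + 1)) ^ (3 / 2 : ℝ) :=
          mul_le_mul ih bernoulli (by positivity) ((nonneg n hn).trans ih)
      _ = _ := by rw [mul_assoc, hmul]

theorem exists_sq_hermiteP_div_factorial_le (x : ℝ) :
    ∃ (N : ℕ) (C : ℝ), ∀ n ≥ N,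
      hermiteP (n + 1) x ^ 2 / (n + 1).factorial ≤ C * ((n : ℝ) + 1) ^ (1 / 2 : ℝ) := by
  obtain ⟨N, hN⟩ := exists_nat_ge (3 / 4 * x ^ 2)
  refine ⟨N, 3 / 2 * hermiteEnergy x N, fun n hn => ?_⟩
  have hNn : (N : ℝ) ≤ n := by exact_mod_cast hn
  have hpos : (0 : ℝ) < n + 1 := by positivity
  have hpow : ((n : ℝ) + 1) ^ (3 / 2 : ℝ) = ((n : ℝ) + 1) ^ (1 / 2 : ℝ) * (n + 1) := by
    rw [← Real.rpow_add_one hpos.ne']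
    norm_num
  calc _ ≤ 3 / 2 / ((n : ℝ) + 1) * hermiteEnergy x n :=
        sq_hermiteP_div_factorial_le (by linarith)
    _ ≤ 3 / 2 / ((n : ℝ) + 1) * (hermiteEnergy x N * ((n : ℝ) + 1) ^ (3 / 2 : ℝ)) := by
        gcongr
        exact (hermiteEnergy_le hN hn).2
    _ = _ := by
        rw [hpow]
        field_simp

theorem sq_hermiteFun (n : ℕ) (t : ℝ) :
    hermiteFun (n + 1) t ^ 2 = (Real.pi ^ (-(1/4) : ℝ) * Real.exp (-(t^2) / 2)) ^ 2 *
      (hermiteP n (Real.sqrt 2 * t) ^ 2 / n.factorial) := by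
  have h : ((n.factorial : ℝ) ^ (-(1/2) : ℝ)) ^ 2 = (n.factorial : ℝ)⁻¹ := by
    rw [← Real.rpow_natCast, ← Real.rpow_mul (by positivity), ← Real.rpow_neg_one]
    norm_num
  rw [hermiteFun, Nat.add_sub_cancel, div_eq_mul_inv (hermiteP _ _ ^ 2), ← h]
  ring

/-- The singular white noise belongs to the Hida distribution space (coefficient form):
for every `t ∈ ℝ` and every real `q ≥ 2`, the series `Σ_{k=1}^∞ e_k(t)² (2k)^{−q}`
converges. -/
theorem singular_whiteNoise_coefficients (t : ℝ) (q : ℝ) (hq : 2 ≤ q) :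
    Summable (fun k : ℕ =>
      (hermiteFun (k + 1) t)^2 * ((2 * (k + 1) : ℕ) : ℝ) ^ (-q)) := by
  obtain ⟨N, C, hC⟩ := exists_sq_hermiteP_div_factorial_le (Real.sqrt 2 * t)
  set A := (Real.pi ^ (-(1/4) : ℝ) * Real.exp (-(t^2) / 2)) ^ 2 with hA
  have hsum : Summable fun n : ℕ => A * C * (((n + N + 1 : ℕ) : ℝ) ^ (-(3 / 2) : ℝ)) :=
    ((summable_nat_add_iff (N + 1)).2
      (Real.summable_nat_rpow.2 (by norm_num : (-(3 / 2) : ℝ) < -1))).mul_left _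
  refine (summable_nat_add_iff (N + 1)).1 (hsum.of_nonneg_of_le (fun n => by positivity) ?_)
  intro n
  have hb := hC (n + N) (Nat.le_add_left N n)
  have hpos : (0 : ℝ) < ((n + N : ℕ) : ℝ) + 1 := by positivity
  have hbase : ((n + N : ℕ) : ℝ) + 1 ≤ ((2 * (n + (N + 1) + 1) : ℕ) : ℝ) := by
    exact_mod_cast (by omega : n + N + 1 ≤ 2 * (n + (N + 1) + 1))
  have hw : ((2 * (n + (N + 1) + 1) : ℕ) : ℝ) ^ (-q) ≤ (((n + N : ℕ) : ℝ) + 1) ^ (-2 : ℝ) :=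
    (Real.rpow_le_rpow_of_nonpos hpos hbase (by linarith)).trans
      (Real.rpow_le_rpow_of_exponent_le (le_add_of_nonneg_left (Nat.cast_nonneg _))
        (by linarith))
  rw [sq_hermiteFun, ← hA]
  calc _ ≤ A * (C * (((n + N : ℕ) : ℝ) + 1) ^ (1 / 2 : ℝ)) *
        (((n + N : ℕ) : ℝ) + 1) ^ (-2 : ℝ) := by
        refine mul_le_mul (mul_le_mul_of_nonneg_left hb (by positivity)) hw (by positivity) ?_
        exact mul_nonneg (by positivity) (le_trans (by positivity) hb)
    _ = _ := by
        rw [mul_assoc A, mul_assoc C, ← Real.rpow_add hpos]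
        push_cast
        norm_num [mul_assoc]

end
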